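/- Let G = (L, R, E) be an (ε, β)-additive sampler in which every vertex of R has degree at least k and every vertex of L has probability mass at most 1/k, and suppose exp(-0.01·ε²·k) < 1/4. Then G is a (2ε, 4β)-function additive sampler: for every f : R → [0,1] with mean μ, the fraction of v ∈ L with |E_{u∼v}[f(u)] - μ| > 2ε is at most 4β. -/

import Mathlib

open Finset
open scoped Classical

/-- Expectation of `g` over the random subset of `s` that contains each `i ∈ s` independently
with probability `p i`. -/
noncomputable def bernoulliExp {ι : Type*} (p : ι → ℝ) (s : Finset ι) (g : Finset ι → ℝ) : ℝ :=
  ∑ A ∈ s.powerset, ((∏ i ∈ A, p i) * ∏ i ∈ s \ A, (1 - p i)) * g A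

section BernoulliExp

variable {ι : Type*} {p d : ι → ℝ} {s : Finset ι}

lemma bernoulliExp_empty (p : ι → ℝ) (g : Finset ι → ℝ) : bernoulliExp p ∅ g = g ∅ := by
  simp [bernoulliExp]

lemma bernoulliExp_insert (p : ι → ℝ) {a : ι} (ha : a ∉ s) (g : Finset ι → ℝ) :
    bernoulliExp p (insert a s) g =
      (1 - p a) * bernoulliExp p s g + p a * bernoulliExp p s (fun A => g (insert a A)) := by
  unfold bernoulliExp
  rw [sum_powerset_insert ha, mul_sum, mul_sum]
  congr 1
  · refine sum_congr rfl fun A hA => ?_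
    have haA : a ∉ A := fun h => ha (mem_powerset.1 hA h)
    rw [insert_sdiff_of_notMem _ haA, prod_insert (by simp [ha])]
    ring
  · refine sum_congr rfl fun A hA => ?_
    have haA : a ∉ A := fun h => ha (mem_powerset.1 hA h)
    rw [prod_insert haA, insert_sdiff_insert, sdiff_insert_of_notMem ha]
    ring

lemma bernoulliExp_const (p : ι → ℝ) (s : Finset ι) (c : ℝ) :
    bernoulliExp p s (fun _ => c) = c := by
  induction s using Finset.induction_on with
  | empty => exact bernoulliExp_empty _ _
  | insert a s ha ih => rw [bernoulliExp_insert p ha, ih]; ring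

lemma bernoulliExp_sub (p : ι → ℝ) (s : Finset ι) (g h : Finset ι → ℝ) :
    bernoulliExp p s (fun A => g A - h A) = bernoulliExp p s g - bernoulliExp p s h := by
  simp only [bernoulliExp, mul_sub, sum_sub_distrib]

lemma bernoulliExp_mul_left (p : ι → ℝ) (s : Finset ι) (c : ℝ) (g : Finset ι → ℝ) :
    bernoulliExp p s (fun A => c * g A) = c * bernoulliExp p s g := by
  simp only [bernoulliExp, mul_sum]
  exact sum_congr rfl fun A _ => by ring

lemma bernoulliExp_sum (p : ι → ℝ) (s : Finset ι) {κ : Type*} (T : Finset κ)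
    (g : κ → Finset ι → ℝ) :
    bernoulliExp p s (fun A => ∑ v ∈ T, g v A) = ∑ v ∈ T, bernoulliExp p s (g v) := by
  simp only [bernoulliExp, mul_sum]
  exact sum_comm

lemma bernoulliExp_mono (hp0 : ∀ i, 0 ≤ p i) (hp1 : ∀ i, p i ≤ 1) {g h : Finset ι → ℝ}
    (hgh : ∀ A, g A ≤ h A) : bernoulliExp p s g ≤ bernoulliExp p s h :=
  sum_le_sum fun A _ => mul_le_mul_of_nonneg_left (hgh A) <|
    mul_nonneg (prod_nonneg fun i _ => hp0 i) (prod_nonneg fun i _ => sub_nonneg.2 (hp1 i))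

lemma bernoulliExp_sq (p d : ι → ℝ) (s : Finset ι) (c : ℝ) :
    bernoulliExp p s (fun A => (c + ∑ i ∈ A, d i) ^ 2) =
      (c + ∑ i ∈ s, d i * p i) ^ 2 + ∑ i ∈ s, d i ^ 2 * (p i * (1 - p i)) := by
  induction s using Finset.induction_on generalizing c with
  | empty => simp [bernoulliExp_empty]
  | insert a s ha ih =>
    have hins : bernoulliExp p s (fun A => (c + ∑ i ∈ insert a A, d i) ^ 2) =
        bernoulliExp p s (fun A => (c + d a + ∑ i ∈ A, d i) ^ 2) := by
      refine sum_congr rfl fun A hA => ?_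
      beta_reduce
      rw [sum_insert fun h => ha (mem_powerset.1 hA h), add_assoc]
    rw [bernoulliExp_insert p ha, hins, ih, ih, sum_insert ha, sum_insert ha]
    ring

/-- Cantelli's inequality for a weighted sum of independent Bernoulli variables. -/
lemma le_bernoulliExp_tail (hp0 : ∀ i, 0 ≤ p i) (hp1 : ∀ i, p i ≤ 1) {t : ℝ} (ht : 0 < t)
    (hm : 2 * t < ∑ i ∈ s, d i * p i) :
    (2 * t) ^ 2 / ((2 * t) ^ 2 + ∑ i ∈ s, d i ^ 2) ≤
      bernoulliExp p s (fun A => if t < |∑ i ∈ A, d i| then 1 else 0) := by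
  set m := ∑ i ∈ s, d i * p i with hmdef
  set y := ∑ i ∈ s, d i ^ 2
  set P := bernoulliExp p s (fun A => if t < |∑ i ∈ A, d i| then (1 : ℝ) else 0)
  have hy : 0 ≤ y := sum_nonneg fun i _ => sq_nonneg _
  have hV : ∑ i ∈ s, d i ^ 2 * (p i * (1 - p i)) ≤ y / 4 := by
    rw [sum_div]
    refine sum_le_sum fun i _ => ?_
    nlinarith [mul_nonneg (sq_nonneg (d i)) (sq_nonneg (2 * p i - 1))]
  set a := m - t with hadef
  have hat : t < a := by linarith
  have ha : 0 < a := ht.trans hat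
  set b := y / 4 / a with hbdef
  have hb : 0 ≤ b := by positivity
  have hab : a * b = y / 4 := by rw [hbdef]; field_simp
  have key : (a + b) ^ 2 - ((-(m + b) + m) ^ 2 +
      ∑ i ∈ s, d i ^ 2 * (p i * (1 - p i))) ≤ (a + b) ^ 2 * P := by
    rw [← bernoulliExp_mul_left, hmdef, ← bernoulliExp_sq, ← hmdef,
      ← bernoulliExp_const p s ((a + b) ^ 2), ← bernoulliExp_sub, bernoulliExp_const]
    refine bernoulliExp_mono hp0 hp1 fun A => ?_
    split_ifs with h
    · nlinarith [sq_nonneg (-(m + b) + ∑ i ∈ A, d i)]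
    · have := (le_abs_self _).trans (not_lt.1 h)
      nlinarith [mul_nonneg (add_nonneg ha.le hb) (sub_nonneg.2 this),
        sq_nonneg (t - ∑ i ∈ A, d i)]
  have h1 : a ^ 2 + y / 4 ≤ (a + b) ^ 2 * P := by nlinarith
  have h2 : (a + b) ^ 2 * a ^ 2 = (a ^ 2 + y / 4) ^ 2 := by rw [← hab]; ring
  have h3 : 0 < a ^ 2 + y / 4 := by positivity
  have h4 : a ^ 2 ≤ (a ^ 2 + y / 4) * P := by
    have := mul_le_mul_of_nonneg_right h1 (sq_nonneg a)
    have h5 : (a ^ 2 + y / 4) * a ^ 2 ≤ (a ^ 2 + y / 4) * ((a ^ 2 + y / 4) * P) := by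
      nlinarith
    exact le_of_mul_le_mul_left h5 h3
  have hP : P ≤ 1 := by
    rw [← bernoulliExp_const p s 1]
    exact bernoulliExp_mono hp0 hp1 fun A => by split_ifs <;> norm_num
  rw [div_le_iff₀ (by positivity)]
  nlinarith [mul_nonneg (sub_nonneg.2 hP) (sub_nonneg.2 (pow_le_pow_left₀ ht.le hat.le 2))]

/-- The probability that `|x + ∑ i ∈ s, ± d i| > t` for independent uniform signs. -/
noncomputable def signTail (d : ι → ℝ) (t : ℝ) (s : Finset ι) (x : ℝ) : ℝ :=
  bernoulliExp (fun _ => 1 / 2) s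
    (fun A => if t < |x + (2 * ∑ i ∈ A, d i - ∑ i ∈ s, d i)| then 1 else 0)

lemma signTail_empty (d : ι → ℝ) (t x : ℝ) :
    signTail d t ∅ x = if t < |x| then 1 else 0 := by
  simp [signTail, bernoulliExp_empty]

lemma signTail_insert {a : ι} (ha : a ∉ s) (d : ι → ℝ) (t x : ℝ) :
    signTail d t (insert a s) x =
      (signTail d t s (x - d a) + signTail d t s (x + d a)) / 2 := by
  have hins : bernoulliExp (fun _ => 1 / 2) s (fun A =>
      if t < |x + (2 * ∑ i ∈ insert a A, d i - ∑ i ∈ insert a s, d i)| then (1 : ℝ) else 0) =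
      signTail d t s (x + d a) := by
    refine sum_congr rfl fun A hA => ?_
    beta_reduce
    rw [sum_insert fun h => ha (mem_powerset.1 hA h), sum_insert ha]
    ring_nf
  have hno : bernoulliExp (fun _ => 1 / 2) s (fun A =>
      if t < |x + (2 * ∑ i ∈ A, d i - ∑ i ∈ insert a s, d i)| then (1 : ℝ) else 0) =
      signTail d t s (x - d a) := by
    refine sum_congr rfl fun A _ => ?_
    rw [sum_insert ha]
    ring_nf
  rw [signTail, bernoulliExp_insert _ ha, hins, hno]
  ring

lemma signTail_nonneg (d : ι → ℝ) (t : ℝ) (s : Finset ι) (x : ℝ) : 0 ≤ signTail d t s x := by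
  rw [← bernoulliExp_const (fun _ : ι => 1 / 2) s 0]
  exact bernoulliExp_mono (fun _ => by norm_num) (fun _ => by norm_num)
    fun A => by split_ifs <;> norm_num

lemma one_le_signTail_add (d : ι → ℝ) (t : ℝ) (s : Finset ι) {x z : ℝ} (h : 2 * t < |x + z|) :
    1 ≤ signTail d t s x + signTail d t s z := by
  induction s using Finset.induction_on generalizing x z with
  | empty =>
    have := abs_add_le x z
    rw [signTail_empty, signTail_empty]
    split_ifs <;> linarith
  | insert a s ha ih =>
    have h1 := ih (x := x - d a) (z := z + d a) (by rwa [show x - d a + (z + d a) = x + z by ring])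
    have h2 := ih (x := x + d a) (z := z - d a) (by rwa [show x + d a + (z - d a) = x + z by ring])
    rw [signTail_insert ha, signTail_insert ha]
    linarith

lemma half_le_signTail (d : ι → ℝ) (t : ℝ) (s : Finset ι) {x : ℝ} (h : t < |x|) :
    1 / 2 ≤ signTail d t s x := by
  have := one_le_signTail_add d t s (x := x) (z := x)
    (by rw [← two_mul, abs_mul, abs_two]; linarith)
  linarith

/-- Optional stopping for `S² - Var S` when the walk `S` leaves `[-t, t]`, combined with the
reflection principle. -/
lemma sq_add_le_signTail {t D y x : ℝ} (hd : ∀ i ∈ s, |d i| ≤ D)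
    (hy : D ^ 2 + ∑ i ∈ s, d i ^ 2 ≤ y) (hx : |x| ≤ t) :
    x ^ 2 + ∑ i ∈ s, d i ^ 2 - t ^ 2 ≤ 2 * signTail d t s x * (t ^ 2 + y) := by
  induction s using Finset.induction_on generalizing x with
  | empty =>
    have := sq_le_sq' (abs_le.1 hx).1 (abs_le.1 hx).2
    have hy' : 0 ≤ y := by simp at hy; nlinarith [sq_nonneg D]
    have := mul_nonneg (mul_nonneg zero_le_two (signTail_nonneg d t ∅ x))
      (add_nonneg (sq_nonneg t) hy')
    simp only [sum_empty]
    linarith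
  | insert a s ha ih =>
    rw [sum_insert ha] at hy ⊢
    have ht : 0 ≤ t := (abs_nonneg x).trans hx
    have hda := hd a (mem_insert_self a s)
    have hs : 0 ≤ ∑ i ∈ s, d i ^ 2 := sum_nonneg fun i _ => sq_nonneg _
    have step : ∀ e : ℝ, |e| = |d a| →
        (x + e) ^ 2 + ∑ i ∈ s, d i ^ 2 - t ^ 2 ≤ 2 * signTail d t s (x + e) * (t ^ 2 + y) := by
      intro e he
      rcases le_or_gt |x + e| t with h | h
      · exact ih (fun i hi => hd i (mem_insert_of_mem hi)) (by nlinarith [sq_nonneg (d a)]) h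
      · have hhalf := half_le_signTail d t s h
        have hpos : 0 ≤ t ^ 2 + y := by nlinarith [sq_nonneg D, sq_nonneg t, sq_nonneg (d a)]
        have hle : |x + e| ≤ t + |d a| := (abs_add_le x e).trans (by rw [he]; linarith)
        have hsq : (x + e) ^ 2 ≤ (t + |d a|) ^ 2 := by
          rw [← sq_abs (x + e)]
          exact pow_le_pow_left₀ (abs_nonneg _) hle 2
        have hprod : 2 * t * |d a| ≤ t ^ 2 + D ^ 2 := by
          nlinarith [sq_nonneg (t - D), mul_le_mul_of_nonneg_left hda ht]
        have hsa := sq_abs (d a)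
        nlinarith [mul_le_mul_of_nonneg_right hhalf hpos]
    have h1 := step (d a) rfl
    have h2 := step (-d a) (abs_neg _)
    rw [signTail_insert ha, sub_eq_add_neg x]
    nlinarith

lemma le_signTail {t : ℝ} (ht : 0 < t) (hs : s.Nonempty) :
    (∑ i ∈ s, d i ^ 2 - t ^ 2) / (2 * (t ^ 2 + ∑ i ∈ s, d i ^ 2)) ≤ signTail d t s 0 := by
  obtain ⟨a, has, hmax⟩ := exists_max_image s (fun i => |d i|) hs
  have hy : 0 ≤ ∑ i ∈ s, d i ^ 2 := sum_nonneg fun i _ => sq_nonneg _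
  rw [div_le_iff₀ (by positivity)]
  have hsplit : signTail d t s 0 =
      (signTail d t (s.erase a) (-d a) + signTail d t (s.erase a) (d a)) / 2 := by
    conv_lhs => rw [← insert_erase has]
    rw [signTail_insert (notMem_erase a s), zero_sub, zero_add]
  have hsum : d a ^ 2 + ∑ i ∈ s.erase a, d i ^ 2 = ∑ i ∈ s, d i ^ 2 :=
    add_sum_erase s (fun i => d i ^ 2) has
  rcases le_or_gt |d a| t with h | h
  · have hd : ∀ i ∈ s.erase a, |d i| ≤ |d a| := fun i hi => hmax i (mem_of_mem_erase hi)
    have hD : |d a| ^ 2 + ∑ i ∈ s.erase a, d i ^ 2 ≤ ∑ i ∈ s, d i ^ 2 := by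
      rw [sq_abs, hsum]
    have h1 := sq_add_le_signTail hd hD h
    have h2 := sq_add_le_signTail hd hD ((abs_neg (d a)).trans_le h)
    rw [neg_sq] at h2
    rw [hsplit]
    linarith
  · have h1 := half_le_signTail d t (s.erase a) h
    have h2 := half_le_signTail d t (s.erase a) (x := -d a) (by rwa [abs_neg])
    have h3 : 1 / 2 ≤ signTail d t s 0 := by rw [hsplit]; linarith
    nlinarith [mul_le_mul_of_nonneg_right h3
      (show 0 ≤ 2 * (t ^ 2 + ∑ i ∈ s, d i ^ 2) by positivity), sq_nonneg t]

/-- If `d` sums to zero and has large correlation with `p`, then `d` has large mass on a random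
set drawn either by rounding `p` or uniformly. -/
lemma half_le_bernoulliExp_add (hp0 : ∀ i, 0 ≤ p i) (hp1 : ∀ i, p i ≤ 1) {t : ℝ} (ht : 0 < t)
    (hd : ∑ i ∈ s, d i = 0) (hm : 2 * t < |∑ i ∈ s, d i * p i|) :
    1 / 2 ≤ bernoulliExp p s (fun A => if t < |∑ i ∈ A, d i| then 1 else 0) +
      bernoulliExp (fun _ => 1 / 2) s (fun A => if t < |∑ i ∈ A, d i| then 1 else 0) := by
  have hs : s.Nonempty := by
    rw [nonempty_iff_ne_empty]
    rintro rfl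
    simp at hm
    linarith
  have htail : (2 * t) ^ 2 / ((2 * t) ^ 2 + ∑ i ∈ s, d i ^ 2) ≤
      bernoulliExp p s (fun A => if t < |∑ i ∈ A, d i| then 1 else 0) := by
    rcases lt_abs.1 hm with h | h
    · exact le_bernoulliExp_tail hp0 hp1 ht h
    · have := le_bernoulliExp_tail (d := fun i => -d i) hp0 hp1 ht
        (by simpa only [neg_mul, sum_neg_distrib] using h)
      simpa only [neg_sq, sum_neg_distrib, abs_neg] using this
  have hsign : signTail d (2 * t) s 0 =
      bernoulliExp (fun _ => 1 / 2) s (fun A => if t < |∑ i ∈ A, d i| then 1 else 0) := by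
    simp only [signTail, hd, zero_add, sub_zero, abs_mul, abs_two,
      mul_lt_mul_iff_right₀ (zero_lt_two' ℝ)]
  have h := le_signTail (d := d) (t := 2 * t) (by linarith) hs
  rw [hsign] at h
  have hy : 0 ≤ ∑ i ∈ s, d i ^ 2 := sum_nonneg fun i _ => sq_nonneg _
  have hpos : 0 < (2 * t) ^ 2 + ∑ i ∈ s, d i ^ 2 := by positivity
  refine le_trans (le_of_eq ?_) (add_le_add htail h)
  field_simp
  ring

end BernoulliExp

/-- Let `G = (L,R,E)` be an `(ε,β)`-additive sampler (given by its edge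
distribution `W`) in which every vertex of `R` has degree at least `k` and every vertex of
`L` has probability mass at most `1/k`, and suppose `exp(-0.01·ε²·k) < 1/4`.  Then `G` is a
`(2ε, 4β)`-function additive sampler: for every `f : R → [0,1]` with mean `μ`, the measure
of `v ∈ L` with `|E_{u∼v}[f(u)] - μ| > 2ε` is at most `4β`. -/
theorem stmt_18 {L R : Type*} [Fintype L] [Fintype R]
    (W : L → R → ℝ) (hW0 : ∀ v u, 0 ≤ W v u) (hW1 : (∑ v, ∑ u, W v u) = 1)
    (ε β : ℝ) (hε : 0 < ε) (hβ : 0 < β) (k : ℕ)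
    (hdeg : ∀ u : R, k ≤ (univ.filter (fun v : L => 0 < W v u)).card)
    (hmass : ∀ v : L, (∑ u, W v u) ≤ 1 / (k : ℝ))
    (hk : Real.exp (-0.01 * ε ^ 2 * (k : ℝ)) < 1 / 4)
    (hadd : ∀ A : Finset R,
      (∑ v ∈ univ.filter (fun v : L =>
          ε < |(∑ u ∈ A, W v u) / (∑ u, W v u) - (∑ u ∈ A, (∑ v', W v' u))|),
        (∑ u, W v u)) ≤ β) :
    ∀ f : R → ℝ, (∀ u, 0 ≤ f u) → (∀ u, f u ≤ 1) →
      ∀ μ : ℝ, (∑ u, (∑ v, W v u) * f u) = μ →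
      (∑ v ∈ univ.filter (fun v : L =>
          2 * ε < |(∑ u, W v u * f u) / (∑ u, W v u) - μ|),
        (∑ u, W v u)) ≤ 4 * β := by
  intro f hf0 hf1 μ hμ
  set w : L → ℝ := fun v => ∑ u, W v u with hw
  set q : R → ℝ := fun u => ∑ v, W v u with hq
  have hw0 : ∀ v, 0 ≤ w v := fun v => sum_nonneg fun u _ => hW0 v u
  have hq1 : ∑ u, q u = 1 := by rw [hq, sum_comm]; exact hW1
  let d : L → R → ℝ := fun v u => W v u / w v - q u
  have hdA : ∀ v (A : Finset R), ∑ u ∈ A, d v u = (∑ u ∈ A, W v u) / w v - ∑ u ∈ A, q u :=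
    fun v A => by rw [sum_sub_distrib, ← sum_div]
  let F : (R → ℝ) → L → ℝ := fun p v =>
    bernoulliExp p univ (fun A => if ε < |∑ u ∈ A, d v u| then 1 else 0)
  have hF0 : ∀ p : R → ℝ, (∀ u, 0 ≤ p u) → (∀ u, p u ≤ 1) → ∀ v, 0 ≤ F p v := by
    intro p h0 h1 v
    rw [← bernoulliExp_const p univ 0]
    exact bernoulliExp_mono h0 h1 fun A => by split_ifs <;> norm_num
  have hFβ : ∀ p : R → ℝ, (∀ u, 0 ≤ p u) → (∀ u, p u ≤ 1) → ∑ v, w v * F p v ≤ β := by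
    intro p h0 h1
    rw [← bernoulliExp_const p univ β]
    simp only [F, ← bernoulliExp_mul_left]
    rw [← bernoulliExp_sum]
    refine bernoulliExp_mono h0 h1 fun A => ?_
    simp only [mul_ite, mul_one, mul_zero, ← sum_filter, hdA]
    exact hadd A
  have hhalf0 : ∀ _ : R, (0 : ℝ) ≤ 1 / 2 := fun _ => by norm_num
  have hhalf1 : ∀ _ : R, (1 / 2 : ℝ) ≤ 1 := fun _ => by norm_num
  have hpt : ∀ v, 2 * ε < |(∑ u, W v u * f u) / w v - μ| →
      w v ≤ 2 * (w v * F f v + w v * F (fun _ => 1 / 2) v) := by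
    intro v hv
    rcases (hw0 v).eq_or_lt with h | h
    · simp [← h]
    · have hd0 : ∑ u, d v u = 0 := by
        rw [hdA, hq1, div_self h.ne', sub_self]
      have hdf : ∑ u, d v u * f u = (∑ u, W v u * f u) / w v - μ := by
        rw [← hμ, sum_div, ← sum_sub_distrib]
        exact sum_congr rfl fun u _ => by simp only [d]; ring
      have := half_le_bernoulliExp_add hf0 hf1 hε hd0 (hdf ▸ hv)
      have := mul_le_mul_of_nonneg_left this h.le
      simp only [F]
      linarith
  calc _ ≤ ∑ v ∈ univ.filter (fun v : L => 2 * ε < |(∑ u, W v u * f u) / w v - μ|),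
          2 * (w v * F f v + w v * F (fun _ => 1 / 2) v) :=
        sum_le_sum fun v hv => hpt v (mem_filter.1 hv).2
    _ ≤ ∑ v, 2 * (w v * F f v + w v * F (fun _ => 1 / 2) v) :=
        sum_le_sum_of_subset_of_nonneg (filter_subset _ _) fun v _ _ =>
          mul_nonneg zero_le_two (add_nonneg (mul_nonneg (hw0 v) (hF0 f hf0 hf1 v))
            (mul_nonneg (hw0 v) (hF0 _ hhalf0 hhalf1 v)))
    _ ≤ 4 * β := by
        rw [← mul_sum, sum_add_distrib]
        linarith [hFβ f hf0 hf1, hFβ _ hhalf0 hhalf1]
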